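/- arXiv:1803.09307 — 3 statements merged into one kernel-verified Lean document; each statement's English description precedes it below -/
import Mathlib

section
/- If α, α̃, and β are p.m.p. actions of a countably infinite group Γ and α ⪯ α̃, then α×β ⪯ α̃×β. In particular, the weak equivalence class of a product of two p.m.p. actions depends only on the weak equivalence classes of the factors. -/
open MeasureTheory Filter Topology

/-- A probability-measure-preserving (p.m.p.) action of a group `Γ`,
bundled together with the probability space it acts on. -/
structure PMP (Γ : Type) [Group Γ] where
  /-- the underlying space -/
  X : Type
  /-- the σ-algebra -/
  [mX : MeasurableSpace X]
  /-- the measure -/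
  μ : @Measure X mX
  /-- the measure is a probability measure -/
  [prob : IsProbabilityMeasure μ]
  /-- the action map -/
  act : Γ → X → X
  one_act : ∀ x, act 1 x = x
  mul_act : ∀ γ δ x, act (γ * δ) x = act γ (act δ x)
  /-- each group element acts by a measure-preserving (in particular measurable) map -/
  preserves : ∀ γ, MeasurePreserving (act γ) μ μ

attribute [instance] PMP.mX PMP.prob

variable {Γ : Type} [Group Γ]

/-- A p.m.p. action is free if almost every point has trivial stabilizer. -/
def PMP.Free (a : PMP Γ) : Prop :=
  a.μ {x | ∀ γ : Γ, γ ≠ 1 → a.act γ x ≠ x} = 1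

/-- The vector `M^α_{S,k}[f] ∈ [0,1]^{S×k×k}`, defined by
`M^α_{S,k}[f](γ,i,j) = μ {x | f x = i ∧ f (γ • x) = j}`. -/
noncomputable def PMP.M (a : PMP Γ) (S : Finset Γ) (k : ℕ) (f : a.X → Fin k) :
    ↥S × Fin k × Fin k → ℝ :=
  fun q => (a.μ {x | f x = q.2.1 ∧ f (a.act (q.1 : Γ) x) = q.2.2}).toReal

/-- `C(α,S,k)`: the closure of the set of vectors `M^α_{S,k}[f]`, where `f` ranges over
measurable maps `X → k`, taken in `[0,1]^{S×k×k}`.  (The space `↥S × Fin k × Fin k → ℝ`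
carries the sup metric `dist_∞`, since the product distance on a finite product of copies
of `ℝ` is the max of the coordinate distances.) -/
noncomputable def PMP.C (a : PMP Γ) (S : Finset Γ) (k : ℕ) :
    Set (↥S × Fin k × Fin k → ℝ) :=
  closure {v | ∃ f : a.X → Fin k, Measurable f ∧ a.M S k f = v}

/-- The product of two p.m.p. actions:  `γ • (x, y) = (γ • x, γ • y)` on `(X × Y, μ × ν)`. -/
noncomputable def PMP.prod (a b : PMP Γ) : PMP Γ where
  X := a.X × b.X
  μ := a.μ.prod b.μ
  act γ p := (a.act γ p.1, b.act γ p.2)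
  one_act := by intro p; simp [a.one_act, b.one_act]
  mul_act := by intro γ δ p; simp [a.mul_act, b.mul_act]
  preserves γ := (a.preserves γ).prod (b.preserves γ)

/-- Weak containment: `α ⪯ β` iff `C(α,S,k) ⊆ C(β,S,k)` for all finite `S ⊆ Γ`, `k ∈ ℕ⁺`. -/
def WeakContained {Γ : Type} [Group Γ] (a b : PMP Γ) : Prop :=
  ∀ (S : Finset Γ) (k : ℕ), 0 < k → a.C S k ⊆ b.C S k

/-- Weak equivalence: `α ≃ β` iff `α ⪯ β` and `β ⪯ α`. -/
def WeakEquiv {Γ : Type} [Group Γ] (a b : PMP Γ) : Prop :=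
  WeakContained a b ∧ WeakContained b a

open scoped symmDiff ENNReal

/-- A function on a product that factors through finite measurable partitions of both factors. -/
def FactorsFinitely {X Y Z : Type*} [MeasurableSpace X] [MeasurableSpace Y]
    (g : X × Y → Z) : Prop :=
  ∃ (m n : ℕ) (φ : X → Fin m) (ψ : Y → Fin n) (h : Fin m → Fin n → Z),
    Measurable φ ∧ Measurable ψ ∧ g = fun p => h (φ p.1) (ψ p.2)

namespace FactorsFinitely

variable {X Y : Type*} [MeasurableSpace X] [MeasurableSpace Y]

theorem of_finite {ι κ Z : Type*} [Finite ι] [Finite κ]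
    [MeasurableSpace ι] [DiscreteMeasurableSpace ι]
    [MeasurableSpace κ] [DiscreteMeasurableSpace κ] {φ : X → ι} {ψ : Y → κ}
    (hφ : Measurable φ) (hψ : Measurable ψ) (h : ι → κ → Z) :
    FactorsFinitely fun p : X × Y => h (φ p.1) (ψ p.2) := by
  refine ⟨Nat.card ι, Nat.card κ, Finite.equivFin ι ∘ φ, Finite.equivFin κ ∘ ψ,
    fun u v => h ((Finite.equivFin ι).symm u) ((Finite.equivFin κ).symm v),
    (Measurable.of_discrete).comp hφ, (Measurable.of_discrete).comp hψ, ?_⟩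
  simp

theorem pi {ι Z W : Type*} [Finite ι] {g : ι → X × Y → Z}
    (hg : ∀ i, FactorsFinitely (g i)) (F : (ι → Z) → W) :
    FactorsFinitely fun p => F fun i => g i p := by
  choose m n φ ψ h hφ hψ hgh using hg
  have := of_finite (measurable_pi_lambda (fun x i => φ i x) hφ)
    (measurable_pi_lambda (fun y i => ψ i y) hψ)
    fun u v => F fun i => h i (u i) (v i)
  simpa only [hgh] using this

theorem map₂ {Z Z' : Type*} {f g : X × Y → Z} (hf : FactorsFinitely f)
    (hg : FactorsFinitely g) (F : Z → Z → Z') : FactorsFinitely fun p => F (f p) (g p) := by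
  have := pi (g := fun b : Bool => cond b f g) (by rintro (_ | _) <;> assumption)
    fun w => F (w true) (w false)
  exact this

theorem const {Z : Type*} (z : Z) : FactorsFinitely fun _ : X × Y => z :=
  of_finite (φ := fun _ => ()) (ψ := fun _ => ()) measurable_const measurable_const
    fun _ _ => z

theorem measurable {Z : Type*} [MeasurableSpace Z] {g : X × Y → Z} (hg : FactorsFinitely g) :
    Measurable g := by
  obtain ⟨m, n, φ, ψ, h, hφ, hψ, rfl⟩ := hg
  exact (Measurable.of_discrete (f := fun q : Fin m × Fin n => h q.1 q.2)).comp
    ((hφ.comp measurable_fst).prodMk (hψ.comp measurable_snd))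

theorem prod_mem {s : Set X} {t : Set Y} (hs : MeasurableSet s) (ht : MeasurableSet t) :
    FactorsFinitely fun p : X × Y => p ∈ s ×ˢ t :=
  of_finite (φ := fun x => x ∈ s) (ψ := fun y => y ∈ t) (measurable_mem.2 hs)
    (measurable_mem.2 ht) And

theorem isSetRing : IsSetRing {s : Set (X × Y) | FactorsFinitely fun p => p ∈ s} where
  empty_mem := const False
  union_mem _ _ hs ht := hs.map₂ ht Or
  sdiff_mem _ _ hs ht := hs.map₂ ht fun p q => p ∧ ¬ q

theorem exists_measure_symmDiff_lt (μ : Measure (X × Y)) [IsFiniteMeasure μ]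
    {s : Set (X × Y)} (hs : MeasurableSet s) {ε : ℝ≥0∞} (hε : 0 < ε) :
    ∃ t : Set (X × Y), FactorsFinitely (fun p => p ∈ t) ∧ μ (t ∆ s) < ε := by
  refine exists_measure_symmDiff_lt_of_generateFrom_isSetRing isSetRing
    ⟨{Set.univ}, Set.countable_singleton _, ?_, by simp⟩ (le_antisymm ?_ ?_) hs hε
  · simpa using const (X := X) (Y := Y) True
  · rw [← generateFrom_prod]
    refine MeasurableSpace.generateFrom_mono ?_
    rintro _ ⟨s, hs, t, ht, rfl⟩
    exact prod_mem hs ht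
  · exact MeasurableSpace.generateFrom_le fun t ht => measurableSet_setOfPred.2 ht.measurable

/-- Measurable maps from a product to a finite set are approximated in measure by maps that factor
through finite partitions of the factors. -/
theorem exists_measure_ne_le (μ : Measure (X × Y)) [IsFiniteMeasure μ] {Z : Type*} [Fintype Z]
    [Nonempty Z] [MeasurableSpace Z] [MeasurableSingletonClass Z] {f : X × Y → Z}
    (hf : Measurable f) {ε : ℝ≥0∞} (hε : 0 < ε) :
    ∃ g : X × Y → Z, FactorsFinitely g ∧ μ {p | f p ≠ g p} ≤ ε := by
  classical
  have hδ : 0 < ε / Fintype.card Z := ENNReal.div_pos hε.ne' (by simp)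
  choose t ht hμt using fun z =>
    exists_measure_symmDiff_lt μ (hf (measurableSet_singleton z)) hδ
  refine ⟨_, pi ht fun w => Classical.epsilon w, ?_⟩
  calc μ {p | f p ≠ Classical.epsilon fun z => p ∈ t z}
      ≤ μ (⋃ z, t z ∆ (f ⁻¹' {z})) := by
        refine measure_mono fun p hp => ?_
        by_contra hq
        have key : ∀ z, p ∈ t z ↔ f p = z := by
          intro z
          have : p ∉ t z ∆ (f ⁻¹' {z}) := fun h => hq (Set.mem_iUnion.2 ⟨z, h⟩)
          simp only [Set.mem_symmDiff, Set.mem_preimage, Set.mem_singleton_iff] at this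
          tauto
        exact hp ((key _).1 (Classical.epsilon_spec (p := fun z => p ∈ t z)
          ⟨f p, (key _).2 rfl⟩))
    _ ≤ ∑ z, μ (t z ∆ (f ⁻¹' {z})) := measure_iUnion_fintype_le _ _
    _ ≤ ∑ _z : Z, ε / Fintype.card Z := Finset.sum_le_sum fun z _ => (hμt z).le
    _ = ε := by
        rw [Finset.sum_const, Finset.card_univ, nsmul_eq_mul]
        exact ENNReal.mul_div_cancel (by simp) (by simp)

end FactorsFinitely

namespace PMP

theorem dist_M_le (a : PMP Γ) (S : Finset Γ) (k : ℕ) {f g : a.X → Fin k} (hf : Measurable f)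
    (hg : Measurable g) : dist (a.M S k f) (a.M S k g) ≤ 2 * a.μ.real {x | f x ≠ g x} := by
  refine (dist_pi_le_iff (by positivity)).2 fun q => ?_
  have meas : ∀ {h : a.X → Fin k}, Measurable h →
      MeasurableSet {x | h x = q.2.1 ∧ h (a.act q.1 x) = q.2.2} := fun hh =>
    (hh (measurableSet_singleton _)).inter
      ((hh.comp (a.preserves q.1).measurable) (measurableSet_singleton _))
  have hne : MeasurableSet {x | f x ≠ g x} := (measurableSet_eq_fun hf hg).compl
  rw [Real.dist_eq]
  refine (abs_measureReal_sub_le_measureReal_symmDiff (meas hf).nullMeasurableSet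
    (meas hg).nullMeasurableSet).trans ?_
  calc _ ≤ a.μ.real ({x | f x ≠ g x} ∪ a.act q.1 ⁻¹' {x | f x ≠ g x}) := by
        refine measureReal_mono fun x hx => ?_
        by_contra h
        simp only [Set.mem_union, Set.mem_ofPred_eq, Set.mem_preimage, not_or, not_not] at h
        simp only [Set.mem_symmDiff, Set.mem_ofPred_eq, h.1, h.2, and_not_self, or_self] at hx
    _ ≤ a.μ.real {x | f x ≠ g x} + a.μ.real (a.act q.1 ⁻¹' {x | f x ≠ g x}) :=
        measureReal_union_le _ _
    _ = 2 * a.μ.real {x | f x ≠ g x} := by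
        rw [(a.preserves q.1).measureReal_preimage hne.nullMeasurableSet]
        ring

theorem M_prod (a b : PMP Γ) (S : Finset Γ) (k : ℕ) {m n : ℕ} {φ : a.X → Fin m}
    {ψ : b.X → Fin n} (hφ : Measurable φ) (hψ : Measurable ψ) (h : Fin m → Fin n → Fin k)
    (q : ↥S × Fin k × Fin k) :
    (a.prod b).M S k (fun p => h (φ p.1) (ψ p.2)) q =
      ∑ w : (Fin m × Fin m) × (Fin n × Fin n) with
        h w.1.1 w.2.1 = q.2.1 ∧ h w.1.2 w.2.2 = q.2.2,
        a.M S m φ (q.1, w.1) * b.M S n ψ (q.1, w.2) := by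
  have meas : ∀ (c : PMP Γ) {l : ℕ} {χ : c.X → Fin l} (_ : Measurable χ) (u : Fin l × Fin l),
      MeasurableSet {x | χ x = u.1 ∧ χ (c.act q.1 x) = u.2} := fun c _ _ hχ _ =>
    (hχ (measurableSet_singleton _)).inter
      ((hχ.comp (c.preserves q.1).measurable) (measurableSet_singleton _))
  let R : (Fin m × Fin m) × (Fin n × Fin n) → Set (a.X × b.X) := fun w =>
    {x | φ x = w.1.1 ∧ φ (a.act q.1 x) = w.1.2} ×ˢ {y | ψ y = w.2.1 ∧ ψ (b.act q.1 y) = w.2.2}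
  have hR : ∀ w, (a.μ.prod b.μ).real (R w) = a.M S m φ (q.1, w.1) * b.M S n ψ (q.1, w.2) :=
    fun w => measureReal_prod_prod _ _
  simp_rw [← hR]
  rw [← measureReal_biUnion_finset]
  · change (a.μ.prod b.μ).real {p : a.X × b.X | h (φ p.1) (ψ p.2) = q.2.1 ∧
      h (φ (a.act q.1 p.1)) (ψ (b.act q.1 p.2)) = q.2.2} = _
    congr 1
    ext ⟨x, y⟩
    simp only [R, Set.mem_ofPred_eq, Set.mem_iUnion, Set.mem_prod, Finset.mem_filter,
      Finset.mem_univ, true_and, exists_prop]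
    constructor
    · exact fun hxy => ⟨((φ x, φ (a.act q.1 x)), (ψ y, ψ (b.act q.1 y))), hxy,
        ⟨rfl, rfl⟩, rfl, rfl⟩
    · rintro ⟨⟨⟨_, _⟩, _, _⟩, hxy, ⟨rfl, rfl⟩, rfl, rfl⟩
      exact hxy
  · rintro ⟨⟨_, _⟩, _, _⟩ - ⟨⟨_, _⟩, _, _⟩ - hne
    refine Set.disjoint_left.2 ?_
    rintro ⟨x, y⟩ ⟨⟨rfl, rfl⟩, rfl, rfl⟩ ⟨⟨rfl, rfl⟩, rfl, rfl⟩
    exact hne rfl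
  · exact fun w _ => (meas a hφ w.1).prod (meas b hψ w.2)

end PMP

namespace WeakContained

theorem trans {a b c : PMP Γ} (hab : WeakContained a b) (hbc : WeakContained b c) :
    WeakContained a c :=
  fun S k hk => (hab S k hk).trans (hbc S k hk)

theorem prod_comm (a b : PMP Γ) : WeakContained (a.prod b) (b.prod a) := by
  intro S k _
  refine closure_mono ?_
  rintro _ ⟨f, hf, rfl⟩
  refine ⟨fun p => f p.swap, hf.comp measurable_swap, ?_⟩
  ext q
  have hs : MeasurableSet {x | f x = q.2.1 ∧ f ((a.prod b).act q.1 x) = q.2.2} :=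
    (hf (measurableSet_singleton _)).inter
      ((hf.comp ((a.prod b).preserves q.1).measurable) (measurableSet_singleton _))
  have := (Measure.measurePreserving_swap (μ := b.μ) (ν := a.μ)).measure_preimage
    hs.nullMeasurableSet
  exact congrArg ENNReal.toReal this

theorem prod_right {a a' : PMP Γ} (haa' : WeakContained a a') (b : PMP Γ) :
    WeakContained (a.prod b) (a'.prod b) := by
  intro S k hk
  refine closure_minimal ?_ isClosed_closure
  rintro _ ⟨f, hf, rfl⟩
  rw [← (show IsClosed ((a'.prod b).C S k) from isClosed_closure).closure_eq]
  refine Metric.mem_closure_iff.2 fun ε hε => ?_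
  have : Nonempty (Fin k) := ⟨⟨0, hk⟩⟩
  obtain ⟨g, hg, hfg⟩ := FactorsFinitely.exists_measure_ne_le (a.μ.prod b.μ) hf
    (ENNReal.ofReal_pos.2 (show 0 < ε / 3 by positivity))
  refine ⟨(a.prod b).M S k g, ?_, ?_⟩
  · obtain ⟨m, n, φ, ψ, h, hφ, hψ, rfl⟩ := hg
    have hm : 0 < m := by
      obtain ⟨x⟩ := a.μ.nonempty_of_neZero
      exact (φ x).pos
    let F : (↥S × Fin m × Fin m → ℝ) → (↥S × Fin k × Fin k → ℝ) := fun v q =>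
      ∑ w : (Fin m × Fin m) × (Fin n × Fin n) with
        h w.1.1 w.2.1 = q.2.1 ∧ h w.1.2 w.2.2 = q.2.2, v (q.1, w.1) * b.M S n ψ (q.1, w.2)
    have hF : Continuous F := by fun_prop
    have key : a.M S m φ ∈ a'.C S m := haa' S m hm (subset_closure ⟨φ, hφ, rfl⟩)
    have hFφ : (a.prod b).M S k (fun p => h (φ p.1) (ψ p.2)) = F (a.M S m φ) :=
      funext (PMP.M_prod a b S k hφ hψ h)
    refine Set.mem_of_eq_of_mem hFφ ?_
    refine map_mem_closure hF key ?_
    rintro _ ⟨φ', hφ', rfl⟩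
    exact ⟨fun p => h (φ' p.1) (ψ p.2), FactorsFinitely.measurable ⟨m, n, φ', ψ, h, hφ', hψ, rfl⟩,
      funext (PMP.M_prod a' b S k hφ' hψ h)⟩
  · have h1 := PMP.dist_M_le (a.prod b) S k hf hg.measurable
    have h2 : (a.prod b).μ.real {p | f p ≠ g p} ≤ ε / 3 :=
      ENNReal.toReal_le_of_le_ofReal (by positivity) hfg
    linarith

theorem prod_left (a : PMP Γ) {b b' : PMP Γ} (hbb' : WeakContained b b') :
    WeakContained (a.prod b) (a.prod b') :=
  (prod_comm a b).trans ((hbb'.prod_right a).trans (prod_comm b' a))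

end WeakContained

/-- Corollary 3.4: if `α ⪯ α̃` then `α × β ⪯ α̃ × β`; in particular, the weak equivalence
class of a product of two p.m.p. actions depends only on the weak equivalence classes of
the factors (if `α ≃ α̃` and `β ≃ β̃` then `α × β ≃ α̃ × β̃`). -/
theorem weakContained_prod {Γ : Type} [Group Γ] [Countable Γ] [Infinite Γ]
    (a a' b b' : PMP Γ) :
    (WeakContained a a' → WeakContained (a.prod b) (a'.prod b)) ∧
    (WeakEquiv a a' → WeakEquiv b b' → WeakEquiv (a.prod b) (a'.prod b')) := by
  refine ⟨fun h => h.prod_right b, fun ha hb => ⟨?_, ?_⟩⟩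
  · exact (ha.1.prod_right b).trans (hb.1.prod_left a')
  · exact (ha.2.prod_right b').trans (hb.2.prod_left a)
end

section
/- Let α: Γ ↷ (X,μ) and β: Γ ↷ (Y,ν) be p.m.p. actions of a countably infinite group Γ. For every finite set S ⊆ Γ, every k ∈ ℕ⁺, and every ε > 0, there exists N ∈ ℕ⁺ such that the set {M^{α×β}_{S,k}[f] : f ∈ Step_{k,N}(X,μ;Y,ν)} is an ε-net in C(α×β,S,k). -/
open MeasureTheory Filter Topology

variable {Γ : Type} [Group Γ]

/-- `f ∈ Step_{k,N}(X,μ;Y,ν)`: `f = φ ∘ (g,h)` for measurable `g : X → N`, `h : Y → N`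
and some `φ : N × N → k`. -/
def IsStep {Γ : Type} [Group Γ] (a b : PMP Γ) (k N : ℕ)
    (f : (a.prod b).X → Fin k) : Prop :=
  ∃ (g : a.X → Fin N) (h : b.X → Fin N) (φ : Fin N × Fin N → Fin k),
    Measurable g ∧ Measurable h ∧ ∀ p : a.X × b.X, f p = φ (g p.1, h p.2)

/-- The set `{M^{α×β}_{S,k}[f] : f ∈ Step_{k,N}}` is an ε-net in `C(α×β,S,k)`:
every point of `C(α×β,S,k)` is at `dist_∞`-distance `< ε` from a point of this set. -/
def StepNet {Γ : Type} [Group Γ] (a b : PMP Γ) (S : Finset Γ) (k N : ℕ) (ε : ℝ) : Prop :=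
  ∀ v ∈ (a.prod b).C S k, ∃ f : (a.prod b).X → Fin k,
    IsStep a b k N f ∧ dist v ((a.prod b).M S k f) < ε

/-- `N_{S,k}(α,β,ε)`: the least `N ∈ ℕ⁺` such that `{M^{α×β}_{S,k}[f] : f ∈ Step_{k,N}}`
is an ε-net in `C(α×β,S,k)`. -/
noncomputable def NStep {Γ : Type} [Group Γ] (a b : PMP Γ) (S : Finset Γ) (k : ℕ)
    (ε : ℝ) : ℕ :=
  sInf {N : ℕ | 0 < N ∧ StepNet a b S k N ε}

open scoped symmDiff ENNReal

/-- A map on a product space factors through measurable maps of the two coordinates into `Fin N`. -/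
def IsStepMap {X Y κ : Type*} [MeasurableSpace X] [MeasurableSpace Y] (N : ℕ)
    (f : X × Y → κ) : Prop :=
  ∃ (g : X → Fin N) (h : Y → Fin N) (φ : Fin N × Fin N → κ),
    Measurable g ∧ Measurable h ∧ ∀ p : X × Y, f p = φ (g p.1, h p.2)

section StepMap

variable {X Y κ : Type*} [MeasurableSpace X] [MeasurableSpace Y]

theorem IsStepMap.of_finite [Nonempty κ] {I J : Type*} [Finite I] [Finite J]
    [MeasurableSpace I] [MeasurableSingletonClass I]
    [MeasurableSpace J] [MeasurableSingletonClass J] {N : ℕ}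
    (hI : Nat.card I ≤ N) (hJ : Nat.card J ≤ N) {g : X → I} {h : Y → J}
    (hg : Measurable g) (hh : Measurable h) {f : X × Y → κ}
    (hf : ∀ p q : X × Y, g p.1 = g q.1 → h p.2 = h q.2 → f p = f q) : IsStepMap N f := by
  let e : I → Fin N := Fin.castLE hI ∘ Finite.equivFin I
  let e' : J → Fin N := Fin.castLE hJ ∘ Finite.equivFin J
  have he : Function.Injective e := (Fin.castLE_injective hI).comp (Finite.equivFin I).injective
  have he' : Function.Injective e' :=
    (Fin.castLE_injective hJ).comp (Finite.equivFin J).injective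
  refine ⟨e ∘ g, e' ∘ h,
    Function.extend (fun p : X × Y => (e (g p.1), e' (h p.2))) f fun _ => Classical.arbitrary κ,
    (Measurable.of_discrete (f := e)).comp hg, (Measurable.of_discrete (f := e')).comp hh,
    fun p => ?_⟩
  have hfac : Function.FactorsThrough f (fun p : X × Y => (e (g p.1), e' (h p.2))) := by
    intro p q hpq
    rw [Prod.mk.injEq] at hpq
    exact hf p q (he hpq.1) (he' hpq.2)
  exact (hfac.extend_apply _ p).symm

theorem IsStepMap.mono [Nonempty κ] {f : X × Y → κ} {M N : ℕ} (hf : IsStepMap M f)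
    (hMN : M ≤ N) : IsStepMap N f := by
  obtain ⟨g, h, φ, hg, hh, hf⟩ := hf
  refine .of_finite (by simpa using hMN) (by simpa using hMN) hg hh fun p q hp hq => ?_
  rw [hf, hf, hp, hq]

theorem exists_isStepMap_comp [Nonempty κ] {ι : Type*} [Finite ι] {κ' : Type*}
    {F : ι → X × Y → κ'} (hF : ∀ i, ∃ N, IsStepMap N (F i)) (ψ : (ι → κ') → κ) :
    ∃ N, IsStepMap N fun p => ψ fun i => F i p := by
  choose N g h φ hg hh hf using hF
  refine ⟨_, .of_finite (g := fun x i => g i x) (h := fun y i => h i y) le_rfl le_rfl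
    (measurable_pi_lambda _ hg) (measurable_pi_lambda _ hh) fun p q hp hq => ?_⟩
  congr 1
  funext i
  rw [hf, hf, congrFun hp i, congrFun hq i]

theorem exists_isStepMap_comp₂ [Nonempty κ] {κ' : Type*} {F G : X × Y → κ'}
    (hF : ∃ N, IsStepMap N F) (hG : ∃ N, IsStepMap N G) (ψ : κ' → κ' → κ) :
    ∃ N, IsStepMap N fun p => ψ (F p) (G p) :=
  exists_isStepMap_comp (ι := Bool) (F := fun i => bif i then F else G)
    (fun i => by cases i <;> assumption) fun v => ψ (v true) (v false)

theorem IsStepMap.measurable [MeasurableSpace κ] {N : ℕ} {f : X × Y → κ} (hf : IsStepMap N f) :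
    Measurable f := by
  obtain ⟨g, h, φ, hg, hh, hf⟩ := hf
  rw [funext hf]
  exact (Measurable.of_discrete (f := φ)).comp
    ((hg.comp measurable_fst).prodMk (hh.comp measurable_snd))

theorem exists_isStepMap_mem_prod {s : Set X} {t : Set Y} (hs : MeasurableSet s)
    (ht : MeasurableSet t) : ∃ N, IsStepMap N (· ∈ s ×ˢ t) :=
  ⟨2, .of_finite (I := Prop) (J := Prop) (by simp) (by simp)
    (measurable_mem.2 hs) (measurable_mem.2 ht) fun p q hp hq => by
      simp only [Set.mem_prod, hp, hq]⟩

theorem isSetRing_isStepMap :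
    IsSetRing {s : Set (X × Y) | ∃ N, IsStepMap N (· ∈ s)} where
  empty_mem := by
    simpa using exists_isStepMap_mem_prod (X := X) (Y := Y) MeasurableSet.empty MeasurableSet.empty
  union_mem _ _ hs ht := exists_isStepMap_comp₂ hs ht Or
  sdiff_mem _ _ hs ht := exists_isStepMap_comp₂ hs ht fun p q => p ∧ ¬q

theorem generateFrom_isStepMap :
    (inferInstance : MeasurableSpace (X × Y)) =
      MeasurableSpace.generateFrom {s : Set (X × Y) | ∃ N, IsStepMap N (· ∈ s)} := by
  apply le_antisymm
  · rw [← generateFrom_prod]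
    apply MeasurableSpace.generateFrom_mono
    rintro _ ⟨s, hs, t, ht, rfl⟩
    exact exists_isStepMap_mem_prod hs ht
  · apply MeasurableSpace.generateFrom_le
    rintro s ⟨N, hs⟩
    exact measurable_mem.1 hs.measurable

/-- Measurable maps from a product space to a finite set are approximable in measure by
step maps. -/
theorem exists_isStepMap_measure_ne_lt (μ : Measure (X × Y)) [IsFiniteMeasure μ] {k : ℕ}
    {f : X × Y → Fin k} (hf : Measurable f) (hk : 0 < k) {δ : ℝ≥0∞} (hδ : 0 < δ) :
    ∃ (N : ℕ) (f' : X × Y → Fin k), IsStepMap N f' ∧ μ {p | f p ≠ f' p} < δ := by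
  classical
  have : Nonempty (Fin k) := ⟨⟨0, hk⟩⟩
  have huniv : ∃ D : Set (Set (X × Y)), D.Countable ∧
      D ⊆ {s : Set (X × Y) | ∃ N, IsStepMap N (· ∈ s)} ∧ μ (⋃₀ D)ᶜ = 0 := by
    refine ⟨{Set.univ}, Set.countable_singleton _, ?_, by simp⟩
    rw [Set.singleton_subset_iff, ← Set.univ_prod_univ]
    exact exists_isStepMap_mem_prod .univ .univ
  have hpos : 0 < δ / k := ENNReal.div_pos hδ.ne' (by simp)
  choose A hA hAμ using fun i : Fin k =>
    exists_measure_symmDiff_lt_of_generateFrom_isSetRing (μ := μ) isSetRing_isStepMap huniv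
      generateFrom_isStepMap (hf (measurableSet_singleton i)) hpos
  obtain ⟨N, hN⟩ := exists_isStepMap_comp (κ := Fin k) hA fun v =>
    if h : ∃ i, v i then h.choose else ⟨0, hk⟩
  refine ⟨N, _, hN, ?_⟩
  have hsub : {p | f p ≠ if h : ∃ i, p ∈ A i then h.choose else ⟨0, hk⟩} ⊆
      ⋃ i, A i ∆ (f ⁻¹' {i}) := by
    intro p hp
    by_contra hnot
    have hiff : ∀ i, p ∈ A i ↔ f p = i := by
      intro i
      have := fun h => hnot (Set.mem_iUnion.2 ⟨i, h⟩)
      simp only [Set.mem_symmDiff, Set.mem_preimage, Set.mem_singleton_iff] at this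
      tauto
    have hex : ∃ i, p ∈ A i := ⟨f p, (hiff _).2 rfl⟩
    refine hp ?_
    rw [dif_pos hex]
    exact (hiff _).1 hex.choose_spec
  calc _ ≤ μ (⋃ i, A i ∆ (f ⁻¹' {i})) := measure_mono hsub
    _ ≤ ∑ i, μ (A i ∆ (f ⁻¹' {i})) := measure_iUnion_fintype_le _ _
    _ < ∑ _i : Fin k, δ / k :=
      ENNReal.sum_lt_sum_of_nonempty Finset.univ_nonempty fun i _ => hAμ i
    _ = δ := by
      simp only [Finset.sum_const, Finset.card_univ, Fintype.card_fin, nsmul_eq_mul]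
      exact ENNReal.mul_div_cancel (by simpa using hk.ne') (by simp)

end StepMap

theorem PMP.dist_M_le_s6 (a : PMP Γ) (S : Finset Γ) (k : ℕ) {f f' : a.X → Fin k}
    (hf : Measurable f) (hf' : Measurable f') :
    dist (a.M S k f) (a.M S k f') ≤ 2 * a.μ.real {x | f x ≠ f' x} := by
  refine (dist_pi_le_iff (by positivity)).2 fun ⟨γ, i, j⟩ => ?_
  have hact := (a.preserves γ).measurable
  have hmeas : ∀ {u : a.X → Fin k}, Measurable u →
      MeasurableSet {x | u x = i ∧ u (a.act γ x) = j} := fun hu =>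
    (hu (measurableSet_singleton i)).inter ((hu.comp hact) (measurableSet_singleton j))
  have hne : MeasurableSet {x | f x ≠ f' x} := (measurableSet_eq_fun hf hf').compl
  have hpre : a.μ.real (a.act γ ⁻¹' {x | f x ≠ f' x}) = a.μ.real {x | f x ≠ f' x} :=
    (a.preserves γ).measureReal_preimage hne.nullMeasurableSet
  calc
    _ ≤ a.μ.real ({x | f x = i ∧ f (a.act γ x) = j} ∆ {x | f' x = i ∧ f' (a.act γ x) = j}) :=
      abs_measureReal_sub_le_measureReal_symmDiff (hmeas hf).nullMeasurableSet
        (hmeas hf').nullMeasurableSet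
    _ ≤ a.μ.real ({x | f x ≠ f' x} ∪ a.act γ ⁻¹' {x | f x ≠ f' x}) := by
      refine measureReal_mono fun x hx => ?_
      by_contra hnot
      simp only [Set.mem_union, Set.mem_ofPred_eq, Set.mem_preimage, not_or, not_not] at hnot
      simp only [Set.mem_symmDiff, Set.mem_ofPred_eq, hnot.1, hnot.2] at hx
      tauto
    _ ≤ a.μ.real {x | f x ≠ f' x} + a.μ.real (a.act γ ⁻¹' {x | f x ≠ f' x}) :=
      measureReal_union_le _ _
    _ = 2 * a.μ.real {x | f x ≠ f' x} := by rw [hpre]; ring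

theorem PMP.totallyBounded_M (a : PMP Γ) (S : Finset Γ) (k : ℕ) :
    TotallyBounded {v | ∃ f : a.X → Fin k, Measurable f ∧ a.M S k f = v} := by
  refine (isCompact_Icc (a := (0 : ↥S × Fin k × Fin k → ℝ)) (b := 1)).totallyBounded.subset ?_
  rintro _ ⟨f, -, rfl⟩
  exact ⟨fun _ => ENNReal.toReal_nonneg, fun _ => measureReal_le_one⟩

theorem exists_isStep_dist_M_lt (a b : PMP Γ) (S : Finset Γ) {k : ℕ} (hk : 0 < k)
    {f : (a.prod b).X → Fin k} (hf : Measurable f) {ε : ℝ} (hε : 0 < ε) :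
    ∃ (N : ℕ) (f' : (a.prod b).X → Fin k),
      IsStep a b k N f' ∧ dist ((a.prod b).M S k f) ((a.prod b).M S k f') < ε := by
  obtain ⟨N, f', hstep, hlt⟩ := exists_isStepMap_measure_ne_lt (a.μ.prod b.μ) hf hk
    (ENNReal.ofReal_pos.2 (half_pos hε))
  refine ⟨N, f', hstep, ((a.prod b).dist_M_le_s6 S k hf hstep.measurable).trans_lt ?_⟩
  have hlt' : (a.prod b).μ.real {p | f p ≠ f' p} < ε / 2 :=
    (ENNReal.lt_ofReal_iff_toReal_lt (measure_ne_top (a.μ.prod b.μ) _)).1 hlt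
  linarith

/-- Lemma-Definition 4.1 (existence part): for all finite `S ⊆ Γ`, `k ∈ ℕ⁺` and `ε > 0`
there is `N ∈ ℕ⁺` such that `{M^{α×β}_{S,k}[f] : f ∈ Step_{k,N}(X,μ;Y,ν)}` is an ε-net
in `C(α×β,S,k)`. -/
theorem exists_step_net {Γ : Type} [Group Γ] [Countable Γ] [Infinite Γ]
    (a b : PMP Γ) (S : Finset Γ) (k : ℕ) (hk : 0 < k) (ε : ℝ) (hε : 0 < ε) :
    ∃ N : ℕ, 0 < N ∧ StepNet a b S k N ε := by
  have : Nonempty (Fin k) := ⟨⟨0, hk⟩⟩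
  have hε3 : 0 < ε / 3 := by positivity
  obtain ⟨t, hts, htfin, hcover⟩ :=
    Metric.finite_approx_of_totallyBounded ((a.prod b).totallyBounded_M S k) (ε / 3) hε3
  have happrox : ∀ w : t, ∃ (N : ℕ) (f' : (a.prod b).X → Fin k),
      IsStep a b k N f' ∧ dist w.1 ((a.prod b).M S k f') < ε / 3 := by
    rintro ⟨w, hw⟩
    obtain ⟨f, hf, rfl⟩ := hts hw
    exact exists_isStep_dist_M_lt a b S hk hf hε3
  choose N F hF hdist using happrox
  have := htfin.to_subtype
  obtain ⟨B, hB⟩ := (Set.finite_range N).bddAbove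
  refine ⟨B + 1, B.succ_pos, fun v hv => ?_⟩
  obtain ⟨u, hu, huv⟩ := Metric.mem_closure_iff.1 hv (ε / 3) hε3
  obtain ⟨w, hw, huw⟩ := Set.mem_iUnion₂.1 (hcover hu)
  refine ⟨F ⟨w, hw⟩, IsStepMap.mono (hF ⟨w, hw⟩) ((hB ⟨_, rfl⟩).trans B.le_succ), ?_⟩
  calc _ ≤ dist v u + dist u w + dist w _ := dist_triangle4 _ _ _ _
    _ < ε / 3 + ε / 3 + ε / 3 := add_lt_add (add_lt_add huv huw) (hdist ⟨w, hw⟩)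
    _ = ε := by ring
end

section
/- Let d, n ≥ 2 be integers and let p be the smallest prime divisor of n. Then the group SL_d(ℤ/nℤ) is (p−1)/2-quasirandom, i.e., every nontrivial finite-dimensional unitary representation of SL_d(ℤ/nℤ) over ℂ has dimension at least (p−1)/2. -/
/-- A group `G` is `D`-quasirandom if every nontrivial finite-dimensional unitary
representation of `G` over `ℂ` has dimension at least `D`. -/
def Quasirandom (G : Type*) [Group G] (D : ℝ) : Prop :=
  ∀ (n : ℕ) (ρ : G →* Matrix.unitaryGroup (Fin n) ℂ), (∃ a, ρ a ≠ 1) → D ≤ n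

/-- `ZMod n` has stable range one. -/
lemma ZMod.exists_isUnit_add_mul {n : ℕ} [NeZero n] {a g : ZMod n} (h : IsCoprime a g) :
    ∃ t, IsUnit (a + t * g) := by
  obtain ⟨x, y, hxy⟩ := h
  let t : ℕ := ∏ q ∈ n.primeFactors with ¬ q ∣ a.val, q
  have hcast : a + (t : ZMod n) * g = ((a.val + t * g.val : ℕ) : ZMod n) := by simp
  refine ⟨t, ?_⟩
  rw [hcast, ZMod.isUnit_iff_coprime]
  refine Nat.Coprime.symm (Nat.coprime_of_dvd fun q hq hqn hdvd ↦ ?_)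
  by_cases hqa : q ∣ a.val
  · rcases hq.dvd_mul.1 ((Nat.dvd_add_right hqa).1 hdvd) with ht | hg
    · obtain ⟨r, hr, hqr⟩ := (hq.prime.dvd_finsetProd_iff _).1 ht
      rw [Finset.mem_filter] at hr
      rw [Nat.prime_dvd_prime_iff_eq hq (Nat.prime_of_mem_primeFactors hr.1)] at hqr
      exact hr.2 (hqr ▸ hqa)
    · have hone : ((x.val * a.val + y.val * g.val : ℕ) : ZMod n) = (1 : ℕ) := by simpa using hxy
      rw [ZMod.natCast_eq_natCast_iff] at hone
      have hmod := hone.of_dvd hqn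
      have hzero : q ∣ x.val * a.val + y.val * g.val :=
        dvd_add (hqa.mul_left _) (hg.mul_left _)
      exact hq.one_lt.ne' (Nat.dvd_one.1 ((hmod.dvd_iff dvd_rfl).1 hzero))
  · have ht : q ∣ t := Finset.dvd_prod_of_mem (fun q ↦ q)
      (Finset.mem_filter.2 ⟨Nat.mem_primeFactors.2 ⟨hq, hqn, NeZero.ne n⟩, hqa⟩)
    exact hqa ((Nat.dvd_add_left (ht.mul_right _)).1 hdvd)

namespace Matrix.SpecialLinearGroup

variable {ι R : Type*} [Fintype ι] [DecidableEq ι] [CommRing R]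
  {H : Subgroup (SpecialLinearGroup ι R)}

lemma transvection_mul_apply {i j : ι} (hij : i ≠ j) (c : R) (M : SpecialLinearGroup ι R)
    (l b : ι) :
    (transvection hij c * M) l b = M l b + if l = i then c * M j b else 0 := by
  change (Matrix.transvection i j c * M.1) l b = _
  split_ifs with h
  · subst h
    simp
  · simp [h]

/-- Row operations adding multiples of several rows to one row come from any subgroup
containing the transvections. -/
lemma exists_mem_add_sum_rows
    (hH : ∀ (i j : ι) (hij : i ≠ j) (c : R), transvection hij c ∈ H)
    (c : ι → R) (j : ι) (T : Finset ι) (hj : j ∉ T) :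
    ∃ h ∈ H, ∀ (M : SpecialLinearGroup ι R) (l b : ι),
      (h * M) l b = M l b + if l = j then ∑ k ∈ T, c k * M k b else 0 := by
  induction T using Finset.induction_on with
  | empty => exact ⟨1, H.one_mem, by simp⟩
  | insert i T hi ih =>
    obtain ⟨hji, hjT⟩ : j ≠ i ∧ j ∉ T := by simpa using hj
    obtain ⟨h, hmem, hrow⟩ := ih hjT
    refine ⟨transvection hji (c i) * h, H.mul_mem (hH _ _ _ _) hmem, fun M l b ↦ ?_⟩
    rw [mul_assoc, transvection_mul_apply, hrow, hrow, Finset.sum_insert hi]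
    by_cases hl : l = j
    · simp only [hl, if_true, if_neg hji.symm]
      ring
    · simp [hl]

/-- Row operations adding multiples of one row to several rows come from any subgroup
containing the transvections. -/
lemma exists_mem_add_row
    (hH : ∀ (i j : ι) (hij : i ≠ j) (c : R), transvection hij c ∈ H)
    (c : ι → R) (j : ι) (T : Finset ι) (hj : j ∉ T) :
    ∃ h ∈ H, ∀ (M : SpecialLinearGroup ι R) (l b : ι),
      (h * M) l b = M l b + if l ∈ T then c l * M j b else 0 := by
  induction T using Finset.induction_on with
  | empty => exact ⟨1, H.one_mem, by simp⟩
  | insert i T hi ih =>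
    obtain ⟨hji, hjT⟩ : j ≠ i ∧ j ∉ T := by simpa using hj
    obtain ⟨h, hmem, hrow⟩ := ih hjT
    refine ⟨transvection hji.symm (c i) * h, H.mul_mem (hH _ _ _ _) hmem, fun M l b ↦ ?_⟩
    rw [mul_assoc, transvection_mul_apply, hrow, hrow]
    by_cases hl : l = i
    · subst hl
      simp [hi, hjT]
    · simp [hl]

/-- Gaussian elimination over a ring of stable range one, phrased as an induction on the set `t`
of columns that are not yet columns of the identity matrix. -/
lemma mem_of_forall_transvection_mem_of_columns
    (hR : ∀ a g : R, IsCoprime a g → ∃ t, IsUnit (a + t * g))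
    (hH : ∀ (i j : ι) (hij : i ≠ j) (c : R), transvection hij c ∈ H)
    (t : Finset ι) (M : SpecialLinearGroup ι R)
    (hM : ∀ b ∉ t, ∀ l, M l b = (1 : Matrix ι ι R) l b) : M ∈ H := by
  induction t using Finset.induction_on generalizing M with
  | empty =>
    convert H.one_mem
    ext l b
    exact hM b (Finset.notMem_empty b) l
  | insert j t hj ih =>
    have of_apply_eq_one (M : SpecialLinearGroup ι R)
        (hM : ∀ b ∉ insert j t, ∀ l, M l b = (1 : Matrix ι ι R) l b) (hjj : M j j = 1) :
        M ∈ H := by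
      obtain ⟨h, hmem, hrow⟩ :=
        exists_mem_add_row hH (fun l ↦ -M l j) j (Finset.univ.erase j) (by simp)
      rw [← H.mul_mem_cancel_left hmem]
      refine ih _ fun b hb l ↦ ?_
      rw [hrow]
      by_cases hbj : b = j
      · subst hbj
        by_cases hl : l = b
        · rw [hl, Matrix.one_apply_eq]
          simp [hjj]
        · rw [Matrix.one_apply_ne hl]
          simp [hl, hjj]
      · have hb' : b ∉ insert j t := by simp [hbj, hb]
        rw [hM b hb', hM b hb', Matrix.one_apply_ne (Ne.symm hbj)]
        simp
    rcases t.eq_empty_or_nonempty with rfl | ⟨i, hi⟩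
    · refine of_apply_eq_one M hM ?_
      have hcol : M.1 = (1 : Matrix ι ι R).updateCol j fun l ↦ M l j := by
        ext l b
        by_cases hb : b = j
        · subst hb
          simp
        · rw [Matrix.updateCol_ne hb]
          exact hM b (by simpa using hb) l
      have hdet := M.2
      rw [hcol, ← Matrix.cramer_apply, Matrix.cramer_one] at hdet
      exact hdet
    · have hij : i ≠ j := fun h ↦ hj (h ▸ hi)
      have hsum : ∑ k ∈ insert j t, M⁻¹ j k * M k j = 1 := by
        have hinv (b : ι) : ∑ k, M⁻¹ j k * M k b = (1 : Matrix ι ι R) j b := by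
          have h : (M⁻¹ * M) j b = (1 : SpecialLinearGroup ι R) j b := by rw [inv_mul_cancel]
          rwa [coe_mul, Matrix.mul_apply] at h
        refine Eq.trans (Finset.sum_subset (Finset.subset_univ _) fun k _ hk ↦ ?_)
          ((hinv j).trans (Matrix.one_apply_eq j))
        have hjk : j ≠ k := fun h ↦ hk (by simp [h])
        have hzero := hinv k
        simp only [hM k hk, Matrix.one_apply_ne hjk, Matrix.one_apply, mul_ite, mul_one, mul_zero,
          Finset.sum_ite_eq', Finset.mem_univ, if_true] at hzero
        rw [hzero, zero_mul]
      rw [Finset.sum_insert hj] at hsum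
      obtain ⟨s, hs⟩ := hR (M j j) (∑ k ∈ t, M⁻¹ j k * M k j)
        ⟨M⁻¹ j j, 1, by rw [one_mul, hsum]⟩
      obtain ⟨h₁, hmem₁, hrow₁⟩ := exists_mem_add_sum_rows hH (fun k ↦ s * M⁻¹ j k) j t hj
      rw [← H.mul_mem_cancel_left hmem₁]
      have hunit : IsUnit ((h₁ * M) j j) := by
        rw [hrow₁]
        simpa [Finset.mul_sum, mul_assoc] using hs
      have hcol₁ : ∀ b ∉ insert j t, ∀ l, (h₁ * M) l b = (1 : Matrix ι ι R) l b := by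
        intro b hb l
        have hzero : ∑ k ∈ t, s * M⁻¹ j k * M k b = 0 := Finset.sum_eq_zero fun k hk ↦ by
          rw [hM b hb, Matrix.one_apply_ne fun h ↦ hb (by simp [← h, hk]), mul_zero]
        rw [hrow₁, hM b hb, hzero, ite_self, add_zero]
      generalize h₁ * M = M₁ at hunit hcol₁ ⊢
      obtain ⟨u, hu⟩ := hunit
      rw [← H.mul_mem_cancel_left (hH i j hij (↑u⁻¹ * (1 - M₁ i j))),
        ← H.mul_mem_cancel_left (hH j i hij.symm (1 - M₁ j j))]
      refine of_apply_eq_one _ (fun b hb l ↦ ?_) ?_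
      · have hb' : j ≠ b ∧ i ≠ b := ⟨fun h ↦ hb (by simp [h]), fun h ↦ hb (by simp [← h, hi])⟩
        simp only [transvection_mul_apply, hcol₁ b hb, Matrix.one_apply_ne hb'.1,
          Matrix.one_apply_ne hb'.2]
        simp
      · simp only [transvection_mul_apply, if_true, if_neg hij.symm, ← hu]
        linear_combination (1 - (u : R)) * (1 - M₁ i j) * u.inv_mul

/-- Over a ring of stable range one, the special linear group is generated by transvections. -/
theorem eq_top_of_forall_transvection_mem
    (hR : ∀ a g : R, IsCoprime a g → ∃ t, IsUnit (a + t * g))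
    (hH : ∀ (i j : ι) (hij : i ≠ j) (c : R), transvection hij c ∈ H) : H = ⊤ :=
  (Subgroup.eq_top_iff' H).2 fun M ↦
    mem_of_forall_transvection_mem_of_columns hR hH Finset.univ M (by simp)

lemma transvection_pow {i j : ι} (hij : i ≠ j) (c : R) (k : ℕ) :
    transvection hij c ^ k = transvection hij (k * c) := by
  induction k with
  | zero => simp
  | succ k ih => rw [pow_succ, ih, ← transvection_add, Nat.cast_succ, add_one_mul]

/-- A transvection is conjugate to its power with exponent the square of a unit. -/
lemma isConj_transvection_pow_sq {i j : ι} (hij : i ≠ j) (c : R) {k : ℕ}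
    (hk : IsUnit (k : R)) :
    IsConj (transvection hij c) (transvection hij c ^ k ^ 2) := by
  obtain ⟨u, hu⟩ := hk
  let v : ι → R := fun l ↦ if l = i then ↑u else if l = j then ↑u⁻¹ else 1
  have hdet : (Matrix.diagonal v).det = 1 := by
    rw [Matrix.det_diagonal, ← Finset.mul_prod_erase _ _ (Finset.mem_univ i),
      ← Finset.mul_prod_erase _ _ (Finset.mem_erase.2 ⟨hij.symm, Finset.mem_univ j⟩),
      Finset.prod_eq_one fun l hl ↦ ?_]
    · simp [v, hij.symm]
    · simp only [Finset.mem_erase] at hl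
      simp [v, hl.1, hl.2.1]
  refine isConj_iff.2 ⟨⟨Matrix.diagonal v, hdet⟩, mul_inv_eq_iff_eq_mul.2 ?_⟩
  rw [transvection_pow]
  refine Subtype.ext ?_
  change Matrix.diagonal v * (1 + Matrix.single i j c) =
    (1 + Matrix.single i j (((k ^ 2 : ℕ) : R) * c)) * Matrix.diagonal v
  rw [mul_add, add_mul, mul_one, one_mul]
  congr 1
  ext a b
  rw [Matrix.diagonal_mul, Matrix.mul_diagonal]
  by_cases h : i = a ∧ j = b
  · obtain ⟨rfl, rfl⟩ := h
    simp only [Matrix.single_apply_same, v, if_true, if_neg hij.symm, Nat.cast_pow, ← hu]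
    linear_combination -(u : R) * c * u.mul_inv
  · rw [Matrix.single_apply_of_ne _ _ _ _ _ h, Matrix.single_apply_of_ne _ _ _ _ _ h]
    simp

end Matrix.SpecialLinearGroup

/-- A nontrivial element of finite order in a complex algebra has a nontrivial root of unity in
its spectrum. -/
lemma exists_mem_spectrum_pow_eq_one {A : Type*} [Ring A] [Algebra ℂ A] [FiniteDimensional ℂ A]
    {U : A} {n : ℕ} (hn : n ≠ 0) (hpow : U ^ n = 1) (hU : U ≠ 1) :
    ∃ μ ∈ spectrum ℂ U, μ ^ n = 1 ∧ μ ≠ 1 := by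
  have : Nontrivial A := ⟨⟨U, 1, hU⟩⟩
  let Q : Polynomial ℂ := ∑ k ∈ Finset.range n, Polynomial.X ^ k
  have hQ : Polynomial.aeval U Q = ∑ k ∈ Finset.range n, U ^ k := by simp [Q]
  have hzero : (0 : ℂ) ∈ spectrum ℂ (Polynomial.aeval U Q) := by
    rw [spectrum.zero_mem_iff]
    intro hunit
    have hmul := geom_sum_mul U n
    rw [hpow, sub_self, ← hQ, hunit.mul_right_eq_zero, sub_eq_zero] at hmul
    exact hU hmul
  rw [spectrum.map_polynomial_aeval_of_nonempty U Q
    (spectrum.nonempty_of_isAlgClosed_of_finiteDimensional ℂ U)] at hzero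
  obtain ⟨μ, hμ, hroot⟩ := hzero
  have hgeom : ∑ k ∈ Finset.range n, μ ^ k = 0 := by
    simpa [Q, Polynomial.eval_finsetSum] using hroot
  refine ⟨μ, hμ, ?_, ?_⟩
  · rw [← sub_eq_zero, ← geom_sum_mul, hgeom, zero_mul]
  · rintro rfl
    simp [hn] at hgeom

/-- If `U` has order dividing `n` and is conjugate to `U ^ k ^ 2` for all positive
`k ≤ m`, where `2 * m` is less than the least prime factor of `n`, then its size is at least
`m`. -/
lemma Matrix.le_card_of_isConj_pow_sq {ι : Type*} [Fintype ι] [DecidableEq ι]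
    {U : Matrix ι ι ℂ} {n m : ℕ} (hn : n ≠ 0) (hm : 2 * m < n.minFac) (hpow : U ^ n = 1)
    (hU : U ≠ 1) (hconj : ∀ k, k ≠ 0 → k ≤ m → IsConj U (U ^ k ^ 2)) :
    m ≤ Fintype.card ι := by
  obtain ⟨μ, hμ, hμn, hμ1⟩ := exists_mem_spectrum_pow_eq_one hn hpow hU
  have hroots (k : ℕ) (hk : k ∈ Finset.Icc 1 m) : μ ^ k ^ 2 ∈ U.charpoly.roots.toFinset := by
    rw [Finset.mem_Icc] at hk
    rw [Multiset.mem_toFinset, Polynomial.mem_roots U.charpoly_monic.ne_zero,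
      ← Matrix.mem_spectrum_iff_isRoot_charpoly]
    obtain ⟨c, hc⟩ := hconj k (by omega) hk.2
    have hc' : (c : Matrix ι ι ℂ) * U * (c⁻¹ : (Matrix ι ι ℂ)ˣ) = U ^ k ^ 2 := by
      rw [hc.eq, Units.mul_inv_cancel_right]
    rw [← spectrum.units_conjugate (u := c), hc']
    exact spectrum.pow_image_subset U _ ⟨μ, hμ, rfl⟩
  have hinj {k l : ℕ} (hk : k ∈ Finset.Icc 1 m) (hl : l ∈ Finset.Icc 1 m) (hkl : k < l) :
      μ ^ k ^ 2 ≠ μ ^ l ^ 2 := by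
    rw [Finset.mem_Icc] at hk hl
    intro heq
    have hμ0 : μ ≠ 0 := by
      rintro rfl
      simp [hn] at hμn
    have hsq : l ^ 2 = k ^ 2 + (l + k) * (l - k) := by
      rw [← Nat.sq_sub_sq, Nat.add_sub_cancel' (Nat.pow_le_pow_left hkl.le 2)]
    rw [hsq, pow_add, left_eq_mul₀ (pow_ne_zero _ hμ0)] at heq
    have hcop : n.Coprime ((l + k) * (l - k)) := Nat.Coprime.mul_right
      (Nat.coprime_of_lt_minFac (by omega) (by omega))
      (Nat.coprime_of_lt_minFac (by omega) (by omega))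
    refine hμ1 (orderOf_eq_one_iff.1 (Nat.eq_one_of_dvd_coprimes hcop ?_ ?_))
    · exact orderOf_dvd_of_pow_eq_one hμn
    · exact orderOf_dvd_of_pow_eq_one heq
  calc m = (Finset.Icc 1 m).card := by simp
    _ ≤ U.charpoly.roots.toFinset.card := by
      refine Finset.card_le_card_of_injOn (fun k ↦ μ ^ k ^ 2) hroots fun k hk l hl heq ↦ ?_
      rcases lt_trichotomy k l with hkl | hkl | hkl
      · exact (hinj hk hl hkl heq).elim
      · exact hkl
      · exact (hinj hl hk hkl heq.symm).elim
    _ ≤ U.charpoly.roots.card := Multiset.toFinset_card_le _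
    _ ≤ U.charpoly.natDegree := Polynomial.card_roots' _
    _ = Fintype.card ι := U.charpoly_natDegree_eq_dim

/-- Proposition 5.3 (variant of Frobenius's lemma): for `d, n ≥ 2` with smallest prime
divisor `p` of `n`, the group `SL_d(ℤ/nℤ)` is `(p-1)/2`-quasirandom. -/
theorem SL_zmod_quasirandom (d n : ℕ) (hd : 2 ≤ d) (hn : 2 ≤ n) :
    Quasirandom (Matrix.SpecialLinearGroup (Fin d) (ZMod n))
      (((n.minFac : ℝ) - 1) / 2) := by
  rintro N ρ ⟨a, ha⟩
  have : NeZero n := ⟨by omega⟩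
  obtain ⟨i, j, hij, hU⟩ : ∃ (i j : Fin d) (hij : i ≠ j),
      ρ (Matrix.SpecialLinearGroup.transvection hij 1) ≠ 1 := by
    by_contra! h
    have htop : ρ.ker = ⊤ := Matrix.SpecialLinearGroup.eq_top_of_forall_transvection_mem
      (fun _ _ ↦ ZMod.exists_isUnit_add_mul) fun i j hij c ↦ by
        have hc : Matrix.SpecialLinearGroup.transvection hij c =
            Matrix.SpecialLinearGroup.transvection hij 1 ^ c.val := by
          simp [Matrix.SpecialLinearGroup.transvection_pow]
        rw [hc, MonoidHom.mem_ker, map_pow, h, one_pow]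
    exact ha (MonoidHom.mem_ker.1 (htop ▸ Subgroup.mem_top a))
  let φ := (Matrix.unitaryGroup (Fin N) ℂ).subtype.comp ρ
  let g := Matrix.SpecialLinearGroup.transvection hij (1 : ZMod n)
  have hφ : φ g ≠ 1 := fun h ↦ hU (Subtype.ext h)
  have hpow : φ g ^ n = 1 := by
    rw [← map_pow, Matrix.SpecialLinearGroup.transvection_pow]
    simp
  have hprime := Nat.minFac_prime (show n ≠ 1 by omega)
  have hbound : (n.minFac - 1) / 2 ≤ N := by
    simpa using Matrix.le_card_of_isConj_pow_sq (m := (n.minFac - 1) / 2) (by omega)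
      (by have := hprime.two_le; omega) hpow hφ fun k hk hkm ↦ by
        rw [← map_pow]
        refine φ.map_isConj (Matrix.SpecialLinearGroup.isConj_transvection_pow_sq hij 1 ?_)
        exact (ZMod.isUnit_iff_coprime k n).2
          (Nat.coprime_of_lt_minFac hk (by have := hprime.two_le; omega)).symm
  have hN : N ≠ 0 := by
    rintro rfl
    exact hφ (Subsingleton.elim _ _)
  have hle : n.minFac ≤ 2 * N + 1 := by
    rcases hprime.eq_two_or_odd with h | h <;> omega
  have hle' : (n.minFac : ℝ) ≤ 2 * N + 1 := by exact_mod_cast hle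
  linarith
end
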